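/- Let X be a real Hilbert space, (𝒫,d₁) a metric space, and let g : X × 𝒫 → ℝ ∪ {+∞} with v̂ ∈ ∂_x g(x̄,p̄) satisfy (A2) and (A3), with ℛ the threshold of prox-regularity. Then for every λ ∈ (0, ℛ^{-1}) (with ℛ^{-1} := +∞ if ℛ = 0) and every r > ℛ with λr < 1, the proximal mapping P_λ(v,p) := {x ∈ X : v ∈ x + λ∂_x g(x,p)} admits a single-valued localization π_λ relative to a neighborhood W × P × U of (λv̂ + x̄, p̄, x̄) such that, for some constant ℓ₀ > 0, ‖(v₁−v₂) − 2(1−λr)[π_λ(v₁,p₁) − π_λ(v₂,p₂)]‖ ≤ ‖v₁−v₂‖ + ℓ₀ d₁(p₁,p₂)^{1/2} for all (v₁,p₁),(v₂,p₂) ∈ W × P. -/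

import Mathlib

noncomputable section

open Filter Topology Metric Set MeasureTheory
open scoped RealInnerProductSpace Pointwise

namespace PVS

variable {X : Type*} [NormedAddCommGroup X] [InnerProductSpace ℝ X]
variable {Y : Type*} [NormedAddCommGroup Y] [InnerProductSpace ℝ Y]
variable {W : Type*} [NormedAddCommGroup W] [InnerProductSpace ℝ W]
variable {P : Type*} [MetricSpace P]
variable {Q : Type*} [MetricSpace Q]

/-- Regular (Fréchet) subdifferential of an extended-real-valued function. -/
def regSubdiff (h : X → EReal) (x : X) : Set X :=
  {v | h x ≠ ⊤ ∧ h x ≠ ⊥ ∧ ∀ ε > (0:ℝ), ∀ᶠ u in 𝓝 x,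
      h x + ((⟪v, u - x⟫ - ε * ‖u - x‖ : ℝ) : EReal) ≤ h u}

/-- Weak sequential convergence in an inner product space. -/
def WeakTendsto (xs : ℕ → X) (x : X) : Prop :=
  ∀ z : X, Tendsto (fun k => ⟪xs k, z⟫) atTop (𝓝 ⟪x, z⟫)

/-- Limiting (Mordukhovich) subdifferential. -/
def limSubdiff (h : X → EReal) (x : X) : Set X :=
  {v | ∃ xs vs : ℕ → X, Tendsto xs atTop (𝓝 x) ∧
      Tendsto (fun k => h (xs k)) atTop (𝓝 (h x)) ∧
      (∀ k, vs k ∈ regSubdiff h (xs k)) ∧ WeakTendsto vs v}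

/-- Partial limiting subdifferential with respect to the first variable. -/
def pSubdiff {PP : Type*} (g : X → PP → EReal) (x : X) (p : PP) : Set X :=
  limSubdiff (fun x' => g x' p) x

/-- Graph of a set-valued map. -/
def gph (F : X → Set Y) : Set (X × Y) := {t | t.2 ∈ F t.1}

/-- Regular normal cone. -/
def regNC (Ω : Set X) (x : X) : Set X :=
  {v | ∀ ε > (0:ℝ), ∀ᶠ y in 𝓝[Ω] x, ⟪v, y - x⟫ ≤ ε * ‖y - x‖}

/-- Limiting normal cone. -/
def limNC (Ω : Set X) (x : X) : Set X :=
  {v | ∃ xs vs : ℕ → X, (∀ k, xs k ∈ Ω) ∧ Tendsto xs atTop (𝓝 x) ∧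
      (∀ k, vs k ∈ regNC Ω (xs k)) ∧ Tendsto vs atTop (𝓝 v)}

/-- Regular normal cone to a subset of a product of two inner product spaces,
with the Euclidean product norm. -/
def regNC2 (Ω : Set (X × Y)) (ω : X × Y) : Set (X × Y) :=
  {ζ | ∀ ε > (0:ℝ), ∀ᶠ y in 𝓝[Ω] ω,
      ⟪ζ.1, y.1 - ω.1⟫ + ⟪ζ.2, y.2 - ω.2⟫
        ≤ ε * Real.sqrt (‖y.1 - ω.1‖ ^ 2 + ‖y.2 - ω.2‖ ^ 2)}

/-- Limiting normal cone in a product of two spaces. -/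
def limNC2 (Ω : Set (X × Y)) (ω : X × Y) : Set (X × Y) :=
  {ζ | ∃ ωs ζs : ℕ → X × Y, (∀ k, ωs k ∈ Ω) ∧ Tendsto ωs atTop (𝓝 ω) ∧
      (∀ k, ζs k ∈ regNC2 Ω (ωs k)) ∧ Tendsto ζs atTop (𝓝 ζ)}

/-- Regular coderivative of a set-valued map. -/
def regCoderiv (F : X → Set Y) (u : X) (v : Y) (w : Y) : Set X :=
  {z | (z, -w) ∈ regNC2 (gph F) (u, v)}

/-- Limiting coderivative of a set-valued map. -/
def limCoderiv (F : X → Set Y) (u : X) (v : Y) (w : Y) : Set X :=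
  {z | (z, -w) ∈ limNC2 (gph F) (u, v)}

/-- Regular normal cone in a product of three inner product spaces. -/
def regNC3 (Ω : Set (X × W × Y)) (ω : X × W × Y) : Set (X × W × Y) :=
  {ζ | ∀ ε > (0:ℝ), ∀ᶠ y in 𝓝[Ω] ω,
      ⟪ζ.1, y.1 - ω.1⟫ + ⟪ζ.2.1, y.2.1 - ω.2.1⟫ + ⟪ζ.2.2, y.2.2 - ω.2.2⟫
        ≤ ε * Real.sqrt (‖y.1 - ω.1‖ ^ 2 + ‖y.2.1 - ω.2.1‖ ^ 2 + ‖y.2.2 - ω.2.2‖ ^ 2)}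

/-- Limiting normal cone in a product of three inner product spaces. -/
def limNC3 (Ω : Set (X × W × Y)) (ω : X × W × Y) : Set (X × W × Y) :=
  {ζ | ∃ ωs ζs : ℕ → X × W × Y, (∀ k, ωs k ∈ Ω) ∧ Tendsto ωs atTop (𝓝 ω) ∧
      (∀ k, ζs k ∈ regNC3 Ω (ωs k)) ∧ Tendsto ζs atTop (𝓝 ζ)}

/-- Limiting coderivative of the full partial subdifferential map (x,p) ↦ ∂ₓ g(x,p). -/
def limCoderivFull (g : X → W → EReal) (xb : X) (pb : W) (vh : X) (w : X) : Set (X × W) :=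
  {zs | (zs.1, zs.2, -w) ∈ limNC3 {t : X × W × X | t.2.2 ∈ pSubdiff g t.1 t.2.1} (xb, pb, vh)}

/-- Lipschitz-like (Aubin) property of a set-valued map around a graph point. -/
def LipschitzLike {α Z : Type*} [MetricSpace α] [SeminormedAddCommGroup Z]
    (F : α → Set Z) (ab : α) (zb : Z) : Prop :=
  ∃ ℓ > (0:ℝ), ∃ U ∈ 𝓝 ab, ∃ V ∈ 𝓝 zb,
    ∀ a ∈ U, ∀ a' ∈ U, ∀ z ∈ F a ∩ V, ∃ z' ∈ F a', ‖z - z'‖ ≤ ℓ * dist a a'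

/-- Epigraph of g(·,p). -/
def epi {PP : Type*} (g : X → PP → EReal) (p : PP) : Set (X × ℝ) :=
  {q | g q.1 p ≤ (q.2 : EReal)}

/-- (A1): Lipschitz continuity of the base around the reference point. -/
def A1 (f : X → P → Q → X) (xb : X) (pb : P) (qb : Q) : Prop :=
  ∃ L > (0:ℝ), ∃ ε > (0:ℝ), ∀ x₁ x₂ p₁ p₂ q₁ q₂,
    ‖x₁ - xb‖ < ε → ‖x₂ - xb‖ < ε → dist p₁ pb < ε → dist p₂ pb < ε →
    dist q₁ qb < ε → dist q₂ qb < ε →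
    ‖f x₁ p₁ q₁ - f x₂ p₂ q₂‖ ≤ L * (‖x₁ - x₂‖ + dist p₁ p₂ + dist q₁ q₂)

/-- Parametric prox-regularity with prox-parameter r. -/
def ProxRegWith (g : X → P → EReal) (xb : X) (pb : P) (vh : X) (r : ℝ) : Prop :=
  ∃ ε > (0:ℝ), ∀ x u p v, ‖x - xb‖ < ε → ‖u - xb‖ < ε → dist p pb < ε → ‖v - vh‖ < ε →
    v ∈ pSubdiff g u p →
    g u p + ((⟪v, x - u⟫ - r / 2 * ‖x - u‖ ^ 2 : ℝ) : EReal) ≤ g x p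

/-- Subdifferential continuity with compatible parameterization. -/
def SubdiffCont (g : X → P → EReal) (xb : X) (pb : P) (vh : X) : Prop :=
  Tendsto (fun t : X × P × X => g t.1 t.2.1)
    (𝓝[{t : X × P × X | t.2.2 ∈ pSubdiff g t.1 t.2.1}] (xb, pb, vh)) (𝓝 (g xb pb))

/-- (A2): parametric continuous prox-regularity. -/
def A2 (g : X → P → EReal) (xb : X) (pb : P) (vh : X) : Prop :=
  (∃ r > (0:ℝ), ProxRegWith g xb pb vh r) ∧ SubdiffCont g xb pb vh

/-- Threshold of prox-regularity. -/
def proxThreshold (g : X → P → EReal) (xb : X) (pb : P) (vh : X) : ℝ :=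
  sInf {r : ℝ | 0 < r ∧ ProxRegWith g xb pb vh r}

/-- (A3): basic constraint qualification. -/
def A3 (g : X → P → EReal) (xb : X) (pb : P) : Prop :=
  LipschitzLike (fun p => epi g p) pb (xb, (g xb pb).toReal)

/-- (A4): uniform partial differentiability with partial Jacobian continuous at the point. -/
def A4 (f : X → P → Q → X) (Df : X → P → Q → X →L[ℝ] X) (xb : X) (pb : P) (qb : Q) : Prop :=
  (∃ η > (0:ℝ), ∀ ε > (0:ℝ), ∃ δ > (0:ℝ), ∀ x p q,
      ‖x - xb‖ < η → dist p pb < η → dist q qb < η →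
      ∀ x', ‖x' - x‖ < δ →
        ‖f x' p q - f x p q - Df x p q (x' - x)‖ ≤ ε * ‖x' - x‖) ∧
  Tendsto (fun t : X × P × Q => Df t.1 t.2.1 t.2.2) (𝓝 (xb, pb, qb)) (𝓝 (Df xb pb qb))

/-- Solution map of the parametric variational system. -/
def SolMap (f : X → P → Q → X) (g : X → P → EReal) (v : X) (p : P) (q : Q) : Set X :=
  {x | v - f x p q ∈ pSubdiff g x p}

/-- Single-valued localization of a three-parametric solution map. -/
def Localizes3 (S : X → P → Q → Set X) (V : Set X) (Pn : Set P) (Qn : Set Q) (U : Set X)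
    (ϑ : X → P → Q → X) : Prop :=
  ∀ v ∈ V, ∀ p ∈ Pn, ∀ q ∈ Qn,
    ϑ v p q ∈ U ∧ ϑ v p q ∈ S v p q ∧ ∀ x ∈ U, x ∈ S v p q → x = ϑ v p q

/-- Lipschitzian full stability. -/
def LipFullStable (S : X → P → Q → Set X) (xb vb : X) (pb : P) (qb : Q) : Prop :=
  ∃ V ∈ 𝓝 vb, ∃ Pn ∈ 𝓝 pb, ∃ Qn ∈ 𝓝 qb, ∃ U ∈ 𝓝 xb, ∃ ϑ : X → P → Q → X,
    Localizes3 S V Pn Qn U ϑ ∧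
    ∃ κ > (0:ℝ), ∃ ℓ > (0:ℝ), ∀ v₁ ∈ V, ∀ p₁ ∈ Pn, ∀ q₁ ∈ Qn, ∀ v₂ ∈ V, ∀ p₂ ∈ Pn, ∀ q₂ ∈ Qn,
      ‖(v₁ - v₂) - (2 * κ) • (ϑ v₁ p₁ q₁ - ϑ v₂ p₂ q₂)‖
        ≤ ‖v₁ - v₂‖ + ℓ * (dist p₁ p₂ + dist q₁ q₂)

/-- Hölderian full stability with given moduli. -/
def HolderFullStableWith (S : X → P → Q → Set X) (xb vb : X) (pb : P) (qb : Q) (κ ℓ : ℝ) : Prop :=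
  ∃ V ∈ 𝓝 vb, ∃ Pn ∈ 𝓝 pb, ∃ Qn ∈ 𝓝 qb, ∃ U ∈ 𝓝 xb, ∃ ϑ : X → P → Q → X,
    Localizes3 S V Pn Qn U ϑ ∧
    ∀ v₁ ∈ V, ∀ p₁ ∈ Pn, ∀ q₁ ∈ Qn, ∀ v₂ ∈ V, ∀ p₂ ∈ Pn, ∀ q₂ ∈ Qn,
      ‖(v₁ - v₂) - (2 * κ) • (ϑ v₁ p₁ q₁ - ϑ v₂ p₂ q₂)‖
        ≤ ‖v₁ - v₂‖ + ℓ * (Real.sqrt (dist p₁ p₂) + dist q₁ q₂)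

/-- Hölderian full stability. -/
def HolderFullStable (S : X → P → Q → Set X) (xb vb : X) (pb : P) (qb : Q) : Prop :=
  ∃ κ > (0:ℝ), ∃ ℓ > (0:ℝ), HolderFullStableWith S xb vb pb qb κ ℓ

/-- Neighborhood second-order condition via the regular coderivative of ∂g_p. -/
def SOC (g : X → P → EReal) (A : X →L[ℝ] X) (xb : X) (pb : P) (vh : X) (η κ₀ : ℝ) : Prop :=
  ∀ u p v, ‖u - xb‖ ≤ η → dist p pb ≤ η → ‖v - vh‖ ≤ η → v ∈ pSubdiff g u p →
    ∀ w z, z ∈ regCoderiv (fun y => pSubdiff g y p) u v w →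
      κ₀ * ‖w‖ ^ 2 ≤ ⟪A w, w⟫ + ⟪z, w⟫

/-- The graphical map p ↦ gph ∂ₓ g(·,p). -/
def gphMap (g : X → P → EReal) (p : P) : Set (X × X) := {t | t.2 ∈ pSubdiff g t.1 p}

/-- Local strong monotonicity of f in x with modulus σ. -/
def StrongMono (f : X → P → Q → X) (xb : X) (pb : P) (qb : Q) (σ : ℝ) : Prop :=
  ∃ ε > (0:ℝ), ∀ x₁ x₂ p q, ‖x₁ - xb‖ < ε → ‖x₂ - xb‖ < ε → dist p pb < ε → dist q qb < ε →
    σ * ‖x₁ - x₂‖ ^ 2 ≤ ⟪f x₁ p q - f x₂ p q, x₁ - x₂⟫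

/-- The proximal mapping P_λ(v,p) = {x : v ∈ x + λ ∂ₓ g(x,p)}. -/
def proxMap (g : X → P → EReal) (lam : ℝ) (v : X) (p : P) : Set X :=
  {x | ∃ s ∈ pSubdiff g x p, v = x + lam • s}

/-- Single-valued localization of a two-parametric solution map. -/
def Localizes2 (S : X → P → Set X) (V : Set X) (Pn : Set P) (U : Set X) (ϑ : X → P → X) : Prop :=
  ∀ v ∈ V, ∀ p ∈ Pn, ϑ v p ∈ U ∧ ϑ v p ∈ S v p ∧ ∀ x ∈ U, x ∈ S v p → x = ϑ v p

/-- (Lipschitzian) full stability of a two-parametric system. -/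
def FullStable2 (S : X → P → Set X) (xb vb : X) (pb : P) : Prop :=
  ∃ V ∈ 𝓝 vb, ∃ Pn ∈ 𝓝 pb, ∃ U ∈ 𝓝 xb, ∃ ϑ : X → P → X,
    Localizes2 S V Pn U ϑ ∧
    ∃ κ > (0:ℝ), ∃ ℓ > (0:ℝ), ∀ v₁ ∈ V, ∀ p₁ ∈ Pn, ∀ v₂ ∈ V, ∀ p₂ ∈ Pn,
      ‖(v₁ - v₂) - (2 * κ) • (ϑ v₁ p₁ - ϑ v₂ p₂)‖ ≤ ‖v₁ - v₂‖ + ℓ * dist p₁ p₂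

/-- Normal cone of convex analysis. -/
def convNC (C : Set X) (x : X) : Set X := {v | x ∈ C ∧ ∀ y ∈ C, ⟪v, y - x⟫ ≤ 0}

/-- Solution map of a parametric variational inequality. -/
def SolMapVI (f : X → P → X) (C : Set X) (v : X) (p : P) : Set X :=
  {x | v - f x p ∈ convNC C x}

/-- Radial cone. -/
def radialCone (C : Set X) (x : X) : Set X := {w | ∃ t > (0:ℝ), x + t • w ∈ C}

/-- Tangent cone (closure of the radial cone). -/
def tangentC (C : Set X) (x : X) : Set X := closure (radialCone C x)

/-- Critical cone. -/
def criticalCone (C : Set X) (x v : X) : Set X := tangentC C x ∩ {w | ⟪v, w⟫ = 0}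

/-- Polyhedricity of a closed convex set. -/
def Polyhedric (C : Set X) : Prop :=
  ∀ x ∈ C, ∀ v ∈ convNC C x,
    criticalCone C x v = closure (radialCone C x ∩ {w | ⟪v, w⟫ = 0})

/-- Weak sequential outer limit of critical cones. -/
def Hw (C : Set X) (xb vh : X) : Set X :=
  {w | ∃ xs vs ws : ℕ → X, (∀ k, vs k ∈ convNC C (xs k)) ∧
      Tendsto xs atTop (𝓝 xb) ∧ Tendsto vs atTop (𝓝 vh) ∧
      (∀ k, ws k ∈ criticalCone C (xs k) (vs k)) ∧ WeakTendsto ws w}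

/-- Strong sequential outer limit of critical cones. -/
def Hs (C : Set X) (xb vh : X) : Set X :=
  {w | ∃ xs vs ws : ℕ → X, (∀ k, vs k ∈ convNC C (xs k)) ∧
      Tendsto xs atTop (𝓝 xb) ∧ Tendsto vs atTop (𝓝 vh) ∧
      (∀ k, ws k ∈ criticalCone C (xs k) (vs k)) ∧ Tendsto ws atTop (𝓝 w)}

/-- Convex polyhedron: finite intersection of closed half-spaces. -/
def IsPolyhedron (C : Set X) : Prop :=
  ∃ (k : ℕ) (a : Fin k → X) (b : Fin k → ℝ), C = {x | ∀ i, ⟪a i, x⟫ ≤ b i}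

/-- Legendre form. -/
def LegendreForm (Qf : X → ℝ) : Prop :=
  (∃ A : X →L[ℝ] X, ∀ x, Qf x = ⟪A x, x⟫) ∧
  (∀ (xs : ℕ → X) (x : X), WeakTendsto xs x → Qf x ≤ liminf (fun k => Qf (xs k)) atTop) ∧
  (∀ (xs : ℕ → X) (x : X), WeakTendsto xs x →
     Tendsto (fun k => Qf (xs k)) atTop (𝓝 (Qf x)) → Tendsto xs atTop (𝓝 x))

/-- (A1) for a two-parametric base mapping. -/
def A1two (f : X → P → X) (xb : X) (pb : P) : Prop :=
  ∃ L > (0:ℝ), ∃ ε > (0:ℝ), ∀ x₁ x₂ p₁ p₂,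
    ‖x₁ - xb‖ < ε → ‖x₂ - xb‖ < ε → dist p₁ pb < ε → dist p₂ pb < ε →
    ‖f x₁ p₁ - f x₂ p₂‖ ≤ L * (‖x₁ - x₂‖ + dist p₁ p₂)

/-- (A4) for a two-parametric base mapping. -/
def A4two (f : X → P → X) (Df : X → P → X →L[ℝ] X) (xb : X) (pb : P) : Prop :=
  (∃ η > (0:ℝ), ∀ ε > (0:ℝ), ∃ δ > (0:ℝ), ∀ x p,
      ‖x - xb‖ < η → dist p pb < η →
      ∀ x', ‖x' - x‖ < δ → ‖f x' p - f x p - Df x p (x' - x)‖ ≤ ε * ‖x' - x‖) ∧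
  Tendsto (fun t : X × P => Df t.1 t.2) (𝓝 (xb, pb)) (𝓝 (Df xb pb))

/-- Euclidean distance in X × ℝ. -/
def pairDist (a b : X × ℝ) : ℝ := Real.sqrt (‖a.1 - b.1‖ ^ 2 + |a.2 - b.2| ^ 2)

/-- Pompeiu–Hausdorff distance between subsets of X × ℝ (Euclidean product norm). -/
def hausPH (C₁ C₂ : Set (X × ℝ)) : ℝ :=
  sInf {η : ℝ | 0 ≤ η ∧ (∀ a ∈ C₁, ∃ b ∈ C₂, pairDist a b ≤ η) ∧
                 ∀ b ∈ C₂, ∃ a ∈ C₁, pairDist a b ≤ η}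

/-- Nonparametric prox-regularity with parameter r. -/
def ProxRegWithNP (g : X → EReal) (xb vh : X) (r : ℝ) : Prop :=
  ∃ ε > (0:ℝ), ∀ x u v, ‖x - xb‖ < ε → ‖u - xb‖ < ε → ‖v - vh‖ < ε →
    v ∈ limSubdiff g u → g u ≤ g xb + (ε : EReal) →
    g u + ((⟪v, x - u⟫ - r / 2 * ‖x - u‖ ^ 2 : ℝ) : EReal) ≤ g x

/-- Nonparametric subdifferential continuity. -/
def SubdiffContNP (g : X → EReal) (xb vh : X) : Prop :=
  Tendsto (fun t : X × X => g t.1) (𝓝[gph (limSubdiff g)] (xb, vh)) (𝓝 (g xb))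

/-- Nonparametric threshold of prox-regularity. -/
def proxThresholdNP (g : X → EReal) (xb vh : X) : ℝ :=
  sInf {r : ℝ | 0 < r ∧ ProxRegWithNP g xb vh r}


lemma regSubdiff_subset_limSubdiff (h : X → EReal) (x : X) :
    regSubdiff h x ⊆ limSubdiff h x := fun v hv =>
  ⟨fun _ => x, fun _ => v, tendsto_const_nhds, tendsto_const_nhds, fun _ => hv,
    fun _ => tendsto_const_nhds⟩

/-- The value at `w` of the height functional perturbed by the quadratic
`θ.1 * ‖x‖ ^ 2 - 2 * ⟪θ.2, x⟫`. -/
def perturbedHeight (θ : ℝ × X) (w : X × ℝ) : ℝ :=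
  w.2 + θ.1 * ‖w.1‖ ^ 2 - 2 * ⟪θ.2, w.1⟫

lemma perturbedHeight_add (θ : ℝ × X) (μ : ℝ) (x : X) (w : X × ℝ) :
    perturbedHeight (θ + (μ, μ • x)) w
      = perturbedHeight θ w + μ * (‖w.1 - x‖ ^ 2 - ‖x‖ ^ 2) := by
  simp only [perturbedHeight, Prod.fst_add, Prod.snd_add, inner_add_left, real_inner_smul_left,
    norm_sub_sq_real, real_inner_comm x w.1]
  ring

lemma abs_perturbation_le {θ : ℝ × X} {x : X} {B : ℝ} (hx : ‖x‖ ≤ B) :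
    |θ.1 * ‖x‖ ^ 2 - 2 * ⟪θ.2, x⟫| ≤ ‖θ‖ * (B ^ 2 + 2 * B) := by
  have hB : 0 ≤ B := (norm_nonneg x).trans hx
  have h1 : |θ.1 * ‖x‖ ^ 2| ≤ ‖θ‖ * B ^ 2 := by
    rw [abs_mul, abs_of_nonneg (sq_nonneg ‖x‖)]
    have := norm_fst_le θ
    rw [Real.norm_eq_abs] at this
    gcongr
  have h2 : |2 * ⟪θ.2, x⟫| ≤ ‖θ‖ * (2 * B) := by
    rw [abs_mul, abs_two]
    have := (abs_real_inner_le_norm θ.2 x).trans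
      (mul_le_mul (norm_snd_le θ) hx (norm_nonneg _) (norm_nonneg _))
    linarith
  have := abs_sub (θ.1 * ‖x‖ ^ 2) (2 * ⟪θ.2, x⟫)
  linarith

/-- A smooth variational principle of Borwein–Preiss type: the height functional on a closed set
with bounded projection to `X` and heights bounded below attains its minimum after an arbitrarily
small quadratic perturbation. -/
theorem exists_isMin_perturbedHeight [CompleteSpace X] {E : Set (X × ℝ)} (hE : IsClosed E)
    (hne : E.Nonempty) {K B τ : ℝ} (hK : ∀ w ∈ E, K ≤ w.2) (hB : ∀ w ∈ E, ‖w.1‖ ≤ B)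
    (hτ : 0 < τ) :
    ∃ z ∈ E, ∃ θ : ℝ × X, 0 ≤ θ.1 ∧ ‖θ‖ ≤ τ ∧
      ∀ w ∈ E, perturbedHeight θ z ≤ perturbedHeight θ w := by
  have hB0 : 0 ≤ B := by
    obtain ⟨w, hw⟩ := hne
    exact (norm_nonneg _).trans (hB w hw)
  have hclose : ∀ θ η : ℝ × X, ∀ w ∈ E,
      |perturbedHeight θ w - perturbedHeight η w| ≤ ‖θ - η‖ * (B ^ 2 + 2 * B) := by
    intro θ η w hw
    have := abs_perturbation_le (θ := θ - η) (hB w hw)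
    convert this using 2
    simp only [perturbedHeight, Prod.fst_sub, Prod.snd_sub, inner_sub_left]
    ring
  have hpick : ∀ (θ : ℝ × X) (ε : ℝ), ∃ z ∈ E, 0 < ε → ∀ w ∈ E,
      perturbedHeight θ z ≤ perturbedHeight θ w + ε := by
    intro θ ε
    by_cases hε : 0 < ε
    · have hbdd : BddBelow (perturbedHeight θ '' E) := by
        refine ⟨K - ‖θ‖ * (B ^ 2 + 2 * B), ?_⟩
        rintro _ ⟨w, hw, rfl⟩
        have h1 := (abs_le.1 (abs_perturbation_le (θ := θ) (hB w hw))).1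
        have h2 := hK w hw
        simp only [perturbedHeight]
        linarith
      obtain ⟨_, ⟨z, hz, rfl⟩, hlt⟩ :=
        exists_lt_of_csInf_lt (hne.image (perturbedHeight θ))
          (lt_add_of_pos_right (sInf (perturbedHeight θ '' E)) hε)
      refine ⟨z, hz, fun _ w hw => ?_⟩
      have := csInf_le hbdd (mem_image_of_mem _ hw)
      linarith
    · obtain ⟨z, hz⟩ := hne
      exact ⟨z, hz, fun h => absurd h hε⟩
  choose z hzE hzmin using hpick
  set μ : ℝ := τ / (2 * (1 + B)) with hμ
  have hμ0 : 0 < μ := by positivity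
  let c : ℕ → ℝ := fun n => μ * (1 / 2) ^ n
  let e : ℕ → ℝ := fun n => μ * (1 / 8) ^ n
  have he : ∀ n, 0 < e n := fun n => by positivity
  have hc : ∀ n, 0 < c n := fun n => by positivity
  let θ : ℕ → ℝ × X := fun n => Nat.rec 0
    (fun n t => t + (c n, c n • (z t (e n)).1)) n
  let y : ℕ → X × ℝ := fun n => z (θ n) (e n)
  have hyE : ∀ n, y n ∈ E := fun n => hzE _ _
  have hymin : ∀ n, ∀ w ∈ E, perturbedHeight (θ n) (y n) ≤ perturbedHeight (θ n) w + e n :=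
    fun n => hzmin (θ n) (e n) (he n)
  have hθsucc : ∀ n, θ (n + 1) = θ n + (c n, c n • (y n).1) := fun n => rfl
  have hθdist : ∀ n, dist (θ n) (θ (n + 1)) ≤ (μ * (1 + B)) * (1 / 2) ^ n := by
    intro n
    rw [hθsucc, dist_self_add_right, Prod.norm_mk, norm_smul, Real.norm_eq_abs,
      abs_of_pos (hc n)]
    have h1 := hB _ (hyE n)
    have h2 : c n ≤ c n * (1 + B) := by nlinarith [hc n]
    have h3 : c n * ‖(y n).1‖ ≤ c n * (1 + B) := by
      have := hc n
      gcongr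
      linarith
    calc _ ≤ c n * (1 + B) := max_le h2 h3
      _ = _ := by simp only [c]; ring
  obtain ⟨θl, hθl⟩ := cauchySeq_tendsto_of_complete
    (cauchySeq_of_le_geometric _ _ (by norm_num) hθdist)
  have hxdist : ∀ n, dist (y n).1 (y (n + 1)).1 ≤ 2 * (1 / 2) ^ n := by
    intro n
    have h1 := hymin n _ (hyE (n + 1))
    have h2 := hymin (n + 1) _ (hyE n)
    rw [hθsucc, perturbedHeight_add, perturbedHeight_add, sub_self, norm_zero] at h2
    have h3 : c n * ‖(y (n + 1)).1 - (y n).1‖ ^ 2 ≤ e n + e (n + 1) := by linarith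
    have h4 : e n + e (n + 1) ≤ c n * (2 * (1 / 2) ^ n) ^ 2 := by
      have h8 : ((1 : ℝ) / 8) ^ n = (1 / 2) ^ n * (1 / 2) ^ n * (1 / 2) ^ n := by
        rw [← mul_pow, ← mul_pow]; norm_num
      have h9 : 0 < μ * ((1 / 2) ^ n * (1 / 2) ^ n * (1 / 2) ^ n) := by positivity
      simp only [e, c, pow_succ ((1 : ℝ) / 8), h8]
      nlinarith
    rw [dist_comm, dist_eq_norm]
    exact le_of_sq_le_sq (le_of_mul_le_mul_left (h3.trans h4) (hc n)) (by positivity)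
  obtain ⟨x, hx⟩ := cauchySeq_tendsto_of_complete
    (cauchySeq_of_le_geometric _ _ (by norm_num) hxdist)
  -- `y` is a minimizing sequence for the limit functional
  have happrox : ∀ n, ∀ w ∈ E, perturbedHeight θl (y n) ≤
      perturbedHeight θl w + (e n + 2 * (‖θl - θ n‖ * (B ^ 2 + 2 * B))) := by
    intro n w hw
    have h1 := (abs_le.1 (hclose θl (θ n) (y n) (hyE n))).2
    have h2 := (abs_le.1 (hclose θl (θ n) w hw)).1
    have h3 := hymin n w hw
    linarith
  have herr : Tendsto (fun n => e n + 2 * (‖θl - θ n‖ * (B ^ 2 + 2 * B))) atTop (𝓝 0) := by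
    have h1 : Tendsto e atTop (𝓝 0) := by
      simpa [e] using (tendsto_pow_atTop_nhds_zero_of_lt_one (r := (1 / 8 : ℝ))
        (by norm_num) (by norm_num)).const_mul μ
    have h2 : Tendsto (fun n => ‖θl - θ n‖) atTop (𝓝 0) := by
      simpa using (tendsto_const_nhds.sub hθl).norm (a := θl - θl)
    simpa using h1.add ((h2.mul_const (B ^ 2 + 2 * B)).const_mul 2)
  have hbdd : BddBelow (perturbedHeight θl '' E) := by
    refine ⟨perturbedHeight θl (y 0) - (e 0 + 2 * (‖θl - θ 0‖ * (B ^ 2 + 2 * B))), ?_⟩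
    rintro _ ⟨w, hw, rfl⟩
    linarith [happrox 0 w hw]
  set m := sInf (perturbedHeight θl '' E)
  have hmle : ∀ w ∈ E, m ≤ perturbedHeight θl w := fun w hw => csInf_le hbdd (mem_image_of_mem _ hw)
  have hFlim : Tendsto (fun n => perturbedHeight θl (y n)) atTop (𝓝 m) := by
    refine tendsto_of_tendsto_of_tendsto_of_le_of_le tendsto_const_nhds
      (h := fun n => m + (e n + 2 * (‖θl - θ n‖ * (B ^ 2 + 2 * B))))
      (by simpa using herr.const_add m) (fun n => hmle _ (hyE n)) (fun n => ?_)
    have : perturbedHeight θl (y n) - (e n + 2 * (‖θl - θ n‖ * (B ^ 2 + 2 * B))) ≤ m := by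
      refine le_csInf (hne.image _) ?_
      rintro _ ⟨w, hw, rfl⟩
      linarith [happrox n w hw]
    simp only
    linarith
  have hqlim : Tendsto (fun n => θl.1 * ‖(y n).1‖ ^ 2 - 2 * ⟪θl.2, (y n).1⟫) atTop
      (𝓝 (θl.1 * ‖x‖ ^ 2 - 2 * ⟪θl.2, x⟫)) :=
    ((hx.norm.pow 2).const_mul _).sub ((tendsto_const_nhds.inner hx).const_mul 2)
  have hylim : Tendsto y atTop (𝓝 (x, m - (θl.1 * ‖x‖ ^ 2 - 2 * ⟪θl.2, x⟫))) := by
    refine (Prod.tendsto_iff _ _).2 ⟨hx, ?_⟩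
    refine (hFlim.sub hqlim).congr fun n => ?_
    simp only [perturbedHeight]
    ring
  refine ⟨_, hE.mem_of_tendsto hylim (Eventually.of_forall hyE), θl, ?_, ?_, fun w hw => ?_⟩
  · refine ge_of_tendsto ((continuous_fst.tendsto _).comp hθl) (Eventually.of_forall fun n => ?_)
    induction n with
    | zero => exact le_rfl
    | succ n ih =>
      simp only [Function.comp_apply, hθsucc, Prod.fst_add] at ih ⊢
      linarith [hc n]
  · have := dist_le_of_le_geometric_of_tendsto₀ _ _ (by norm_num) hθdist hθl
    have h0 : θ 0 = 0 := rfl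
    rw [h0, dist_zero_left] at this
    refine this.trans (le_of_eq ?_)
    rw [hμ]
    field_simp
    ring
  · refine le_trans (le_of_eq ?_) (hmle w hw)
    simp only [perturbedHeight]
    ring

/-- Prox-regularity with subgradients at one parameter value and function values at another one,
where the error is linear in the distance of the parameters. -/
def CrossProxReg (g : X → P → EReal) (xb : X) (pb : P) (vh : X) (r C δ : ℝ) : Prop :=
  ∀ u p s, ‖u - xb‖ < δ → dist p pb < δ → ‖s - vh‖ < δ → s ∈ pSubdiff g u p →
    ∃ a : ℝ, g u p = a ∧ ∀ x p' (b : ℝ), ‖x - xb‖ < δ → dist p' pb < δ → g x p' ≤ b →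
      a + ⟪s, x - u⟫ - r / 2 * ‖x - u‖ ^ 2 - C * dist p p' ≤ b

lemma ProxRegWith.mono {g : X → P → EReal} {xb : X} {pb : P} {vh : X} {r r' : ℝ}
    (h : ProxRegWith g xb pb vh r) (hr : r ≤ r') : ProxRegWith g xb pb vh r' := by
  obtain ⟨ε, hε, h⟩ := h
  refine ⟨ε, hε, fun x u p v hx hu hp hv hvs => le_trans ?_ (h x u p v hx hu hp hv hvs)⟩
  gcongr

lemma ProxRegWith.value_ne_top {g : X → P → EReal} {xb : X} {pb : P} {vh : X} {r : ℝ}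
    (h : ProxRegWith g xb pb vh r) (hvh : vh ∈ pSubdiff g xb pb) : g xb pb ≠ ⊤ := by
  obtain ⟨ε, hε, h⟩ := h
  intro htop
  obtain ⟨xs, vs, hxs, -, hvs, -⟩ := id hvh
  obtain ⟨k, hk⟩ := (hxs.eventually (ball_mem_nhds xb hε)).exists
  have := h (xs k) xb pb vh (by simpa [dist_eq_norm] using hk) (by simpa using hε)
    (by simpa using hε) (by simpa using hε) hvh
  rw [htop, EReal.top_add_coe, top_le_iff] at this
  exact (hvs k).1 this

/-- Local consequences of parametric continuous prox-regularity and the basic constraint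
qualification. -/
theorem exists_crossProxReg {g : X → P → EReal} {xb : X} {pb : P} {vh : X}
    (hg_lsc : LowerSemicontinuous fun t : X × P => g t.1 t.2) (hg_proper : ∀ x p, g x p ≠ ⊥)
    (hvh : vh ∈ pSubdiff g xb pb) {r : ℝ} (hr0 : 0 < r) (hr : ProxRegWith g xb pb vh r)
    (hcont : SubdiffCont g xb pb vh) (hA3 : A3 g xb pb) :
    ∃ C > 0, ∃ δ > 0, ∃ ℓ > 0, CrossProxReg g xb pb vh r C δ ∧
      ∀ p, dist p pb < δ → ∃ (x' : X) (a' : ℝ), g x' p ≤ a' ∧ ‖x' - xb‖ ≤ ℓ * dist p pb ∧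
        a' ≤ (g xb pb).toReal + ℓ * dist p pb := by
  obtain ⟨γ, hγ⟩ : ∃ γ : ℝ, g xb pb = γ :=
    ⟨_, (EReal.coe_toReal (hr.value_ne_top hvh) (hg_proper _ _)).symm⟩
  obtain ⟨ℓ, hℓ, U₁, hU₁, V₁, hV₁, hepi⟩ := hA3
  rw [hγ, EReal.toReal_coe] at hV₁ ⊢
  obtain ⟨η₁, hη₁, hU₁⟩ := Metric.mem_nhds_iff.1 hU₁
  obtain ⟨η, hη, hV₁⟩ := Metric.mem_nhds_iff.1 hV₁
  replace hepi : ∀ p p' x (a : ℝ), dist p pb < η₁ → dist p' pb < η₁ → ‖x - xb‖ < η →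
      |a - γ| < η → g x p ≤ a →
      ∃ (x' : X) (a' : ℝ), g x' p' ≤ a' ∧ ‖x' - x‖ ≤ ℓ * dist p p' ∧ a' ≤ a + ℓ * dist p p' := by
    intro p p' x a hp hp' hx ha hle
    obtain ⟨⟨x', a'⟩, hmem, hdist⟩ := hepi p (hU₁ hp) p' (hU₁ hp') (x, a)
      ⟨hle, hV₁ (by simpa [Prod.dist_eq, dist_eq_norm] using ⟨hx, ha⟩)⟩
    rw [Prod.norm_def, max_le_iff] at hdist
    refine ⟨x', a', hmem, by rw [norm_sub_rev]; exact hdist.1, ?_⟩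
    have := (abs_le.1 hdist.2).1
    simp only [Prod.snd_sub] at this
    linarith
  obtain ⟨η₂, hη₂, hr⟩ := hr
  have hlow : ∃ η₃ > 0, ∀ x p, ‖x - xb‖ < η₃ → dist p pb < η₃ →
      ((γ - η : ℝ) : EReal) < g x p := by
    have := hg_lsc (xb, pb) ((γ - η : ℝ) : EReal)
      (by simp only [hγ]; exact_mod_cast sub_lt_self γ hη)
    obtain ⟨η₃, hη₃, h⟩ := Metric.eventually_nhds_iff.1 this
    refine ⟨η₃, hη₃, fun x p hx hp => h (y := (x, p)) ?_⟩
    simpa [Prod.dist_eq, dist_eq_norm] using ⟨hx, by simpa [dist_eq_norm] using hp⟩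
  obtain ⟨η₃, hη₃, hlow⟩ := hlow
  have hval : ∃ η₄ > 0, ∀ u p s, ‖u - xb‖ < η₄ → dist p pb < η₄ → ‖s - vh‖ < η₄ →
      s ∈ pSubdiff g u p → ∃ a : ℝ, g u p = a ∧ a < γ + η / 2 := by
    have h1 : ∀ᶠ y in 𝓝 (g xb pb), y < ((γ + η / 2 : ℝ) : EReal) :=
      eventually_lt_nhds (by rw [hγ]; exact_mod_cast (by linarith : γ < γ + η / 2))
    have h2 := eventually_nhdsWithin_iff.1 (hcont.eventually h1)
    obtain ⟨η₄, hη₄, h⟩ := Metric.eventually_nhds_iff.1 h2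
    refine ⟨η₄, hη₄, fun u p s hu hp hs hmem => ?_⟩
    have hlt := h (y := (u, p, s)) (by
      simp only [Prod.dist_eq, dist_eq_norm u, dist_eq_norm s]
      exact max_lt hu (max_lt hp hs)) hmem
    simp only at hlt
    have hcoe := (EReal.coe_toReal hlt.ne_top (hg_proper u p)).symm
    refine ⟨_, hcoe, ?_⟩
    rw [hcoe] at hlt
    exact_mod_cast hlt
  obtain ⟨η₄, hη₄, hval⟩ := hval
  have hvh0 := norm_nonneg vh
  obtain ⟨δ, hδ, hδ1, hδη, hδη₁, hδη₂, hδη₃, hδη₄, hδ'⟩ : ∃ δ : ℝ, 0 < δ ∧ δ ≤ 1 ∧ δ ≤ η ∧ δ ≤ η₁ ∧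
      δ * (1 + 2 * ℓ) ≤ η₂ ∧ δ ≤ η₃ ∧ δ ≤ η₄ ∧ δ * (2 * (‖vh‖ + 1)) ≤ η / 2 := by
    refine ⟨min 1 (min η (min η₁ (min (η₂ / (1 + 2 * ℓ)) (min η₃ (min η₄
      (η / 2 / (2 * (‖vh‖ + 1)))))))), by positivity, ?_⟩
    rw [← le_div_iff₀ (by positivity), ← le_div_iff₀ (by positivity)]
    simp only [min_le_iff, le_refl, true_or, or_true, and_self]
  refine ⟨ℓ * (2 + ‖vh‖) + r / 2 * ((4 + 2 * ℓ) * ℓ), by positivity, δ, hδ, ℓ, hℓ, ?_,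
    fun p hp => ?_⟩
  · intro u p s hu hp hs hmem
    obtain ⟨a, ha, haγ⟩ := hval u p s (by linarith) (by linarith) (by linarith) hmem
    refine ⟨a, ha, fun x p' b hx hp' hb => ?_⟩
    have hs' : ‖s‖ ≤ ‖vh‖ + 1 := by
      have := norm_le_norm_add_norm_sub' s vh
      linarith
    have hxu : ‖x - u‖ ≤ 2 * δ := by
      rw [← sub_sub_sub_cancel_right x u xb]
      exact (norm_sub_le _ _).trans (by linarith)
    have hd0 : 0 ≤ dist p p' := dist_nonneg
    have hd : dist p p' ≤ 2 * δ := by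
      have := dist_triangle_right p p' pb
      linarith
    have hin := (abs_le.1 (abs_real_inner_le_norm s (x - u))).2
    by_cases hbη : γ + η ≤ b
    · have h1 : ‖s‖ * ‖x - u‖ ≤ (‖vh‖ + 1) * (2 * δ) := by gcongr
      have h2 : 0 ≤ r / 2 * ‖x - u‖ ^ 2 := by positivity
      have h3 : 0 ≤ (ℓ * (2 + ‖vh‖) + r / 2 * ((4 + 2 * ℓ) * ℓ)) * dist p p' := by positivity
      linarith
    · push Not at hbη
      have hlo : γ - η < b := by
        have := (hlow x p' (by linarith) (by linarith)).trans_le hb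
        exact_mod_cast this
      obtain ⟨x', b', hx'b', hx'x, hb'⟩ := hepi p' p x b (by linarith) (by linarith)
        (by linarith) (abs_lt.2 ⟨by linarith, by linarith⟩) hb
      rw [dist_comm p' p] at hx'x hb'
      have hℓd : ℓ * dist p p' ≤ ℓ * (2 * δ) := by gcongr
      have hx' : ‖x' - xb‖ < η₂ := by
        have := norm_sub_le_norm_sub_add_norm_sub x' x xb
        linarith
      have hδη₂' : δ ≤ η₂ := by nlinarith
      have key := (hr x' u p s hx' (by linarith) (by linarith) (by linarith) hmem).trans hx'b'
      rw [ha] at key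
      have key' : a + (⟪s, x' - u⟫ - r / 2 * ‖x' - u‖ ^ 2) ≤ b' := by exact_mod_cast key
      have h1 : ⟪s, x' - u⟫ = ⟪s, x - u⟫ + ⟪s, x' - x⟫ := by
        rw [← inner_add_right]; congr 1; abel
      have h2 : -((‖vh‖ + 1) * (ℓ * dist p p')) ≤ ⟪s, x' - x⟫ := by
        have h3 := (abs_le.1 (abs_real_inner_le_norm s (x' - x))).1
        have h4 : ‖s‖ * ‖x' - x‖ ≤ (‖vh‖ + 1) * (ℓ * dist p p') := by gcongr
        linarith
      have h5 : ‖x' - u‖ ^ 2 ≤ ‖x - u‖ ^ 2 + (4 + 2 * ℓ) * ℓ * dist p p' := by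
        have h6 : ‖x' - u‖ ≤ ‖x - u‖ + ℓ * dist p p' := by
          have := norm_sub_le_norm_sub_add_norm_sub x' x u
          linarith
        have h7 : ‖x' - u‖ ^ 2 ≤ (‖x - u‖ + ℓ * dist p p') ^ 2 := by gcongr
        have h8 : ‖x - u‖ ≤ 2 := by linarith
        have h9 : ℓ * dist p p' ≤ 2 * ℓ := by nlinarith
        have h10 : 0 ≤ ℓ * dist p p' := by positivity
        nlinarith
      have h11 : r / 2 * ‖x' - u‖ ^ 2 ≤ r / 2 * (‖x - u‖ ^ 2 + (4 + 2 * ℓ) * ℓ * dist p p') := by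
        gcongr
      rw [h1] at key'
      linarith
  · rw [dist_comm]
    exact hepi pb p xb γ (by simpa using hη₁) (by linarith) (by simpa using hη)
      (by simpa using hη) hγ.le

lemma CrossProxReg.inner_sub_ge {g : X → P → EReal} {xb : X} {pb : P} {vh : X} {r C δ lam : ℝ}
    (h : CrossProxReg g xb pb vh r C δ) (hlam : 0 < lam) {v₁ v₂ x₁ x₂ s₁ s₂ : X} {p₁ p₂ : P}
    (hx₁ : ‖x₁ - xb‖ < δ) (hx₂ : ‖x₂ - xb‖ < δ) (hp₁ : dist p₁ pb < δ) (hp₂ : dist p₂ pb < δ)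
    (hs₁ : ‖s₁ - vh‖ < δ) (hs₂ : ‖s₂ - vh‖ < δ) (hm₁ : s₁ ∈ pSubdiff g x₁ p₁)
    (hm₂ : s₂ ∈ pSubdiff g x₂ p₂) (hv₁ : v₁ = x₁ + lam • s₁) (hv₂ : v₂ = x₂ + lam • s₂) :
    (1 - lam * r) * ‖x₁ - x₂‖ ^ 2 - 2 * lam * C * dist p₁ p₂ ≤ ⟪v₁ - v₂, x₁ - x₂⟫ := by
  obtain ⟨a₁, ha₁, h₁⟩ := h x₁ p₁ s₁ hx₁ hp₁ hs₁ hm₁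
  obtain ⟨a₂, ha₂, h₂⟩ := h x₂ p₂ s₂ hx₂ hp₂ hs₂ hm₂
  have e₁ := h₁ x₂ p₂ a₂ hx₂ hp₂ ha₂.le
  have e₂ := h₂ x₁ p₁ a₁ hx₁ hp₁ ha₁.le
  rw [norm_sub_rev x₂ x₁, ← neg_sub x₁ x₂, inner_neg_right] at e₁
  rw [dist_comm p₂ p₁] at e₂
  have e₃ : ⟪v₁ - v₂, x₁ - x₂⟫ = ‖x₁ - x₂‖ ^ 2 + lam * (⟪s₁, x₁ - x₂⟫ - ⟪s₂, x₁ - x₂⟫) := by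
    rw [← real_inner_self_eq_norm_sq, ← inner_sub_left, ← real_inner_smul_left, ← inner_add_left,
      hv₁, hv₂]
    congr 1
    module
  have e₄ : 0 ≤ lam * (⟪s₁, x₁ - x₂⟫ - ⟪s₂, x₁ - x₂⟫ + r * ‖x₁ - x₂‖ ^ 2
      + 2 * C * dist p₁ p₂) := mul_nonneg hlam.le (by linarith)
  linarith

/-- If a lower semicontinuous function plus `(2 * lam)⁻¹ * ‖· - v‖ ^ 2` is larger on a sphere than
at some point of the ball, then the proximal inclusion has a solution in the ball for some
right-hand side arbitrarily close to `v`. -/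
theorem exists_regSubdiff_near [CompleteSpace X] {f : X → EReal} (hf : LowerSemicontinuous f)
    (hbot : ∀ x, f x ≠ ⊥) {xb x' v : X} {a' K κ ρ lam : ℝ} (hlam : 0 < lam) (hκ : 0 < κ)
    (hK : ∀ x (b : ℝ), ‖x - xb‖ ≤ ρ → f x ≤ b → K ≤ b)
    (hx' : ‖x' - xb‖ ≤ ρ) (ha' : f x' ≤ a')
    (hsep : ∀ x (b : ℝ), ‖x - xb‖ = ρ → f x ≤ b →
      a' + (2 * lam)⁻¹ * ‖x' - v‖ ^ 2 + κ ≤ b + (2 * lam)⁻¹ * ‖x - v‖ ^ 2)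
    {τ : ℝ} (hτ : 0 < τ) :
    ∃ x s, ‖x - xb‖ < ρ ∧ s ∈ regSubdiff f x ∧ ‖x + lam • s - v‖ ≤ τ := by
  set q : X → ℝ := fun x => (2 * lam)⁻¹ * ‖x - v‖ ^ 2 with hq
  have hq0 : ∀ x, 0 ≤ q x := fun x => by positivity
  let E : Set (X × ℝ) := {z | ‖z.1 - xb‖ ≤ ρ ∧ f z.1 ≤ ((z.2 - q z.1 : ℝ) : EReal)}
  have hE : IsClosed E := by
    refine (isClosed_le (f := fun z : X × ℝ => ‖z.1 - xb‖) (by fun_prop) continuous_const).inter ?_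
    have hc : Continuous fun z : X × ℝ => (z.1, ((z.2 - q z.1 : ℝ) : EReal)) :=
      continuous_fst.prodMk (continuous_coe_real_ereal.comp (by fun_prop))
    exact hf.isClosed_epigraph.preimage hc
  have hmemE : ∀ y (b : ℝ), ‖y - xb‖ ≤ ρ → f y ≤ b → (y, b + q y) ∈ E :=
    fun y b hy hb => ⟨hy, by simpa using hb⟩
  have hρ : 0 ≤ ρ := (norm_nonneg _).trans hx'
  set B : ℝ := ‖xb‖ + ρ
  have hB0 : 0 ≤ B := by positivity
  have hBE : ∀ z ∈ E, ‖z.1‖ ≤ B := fun z hz => by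
    have := norm_le_norm_add_norm_sub' z.1 xb
    linarith [hz.1]
  obtain ⟨τ', hτ', hτ'κ, hτ'τ⟩ : ∃ τ' > 0, τ' * (2 * (B ^ 2 + 2 * B) + 1) ≤ κ ∧
      τ' * (2 * lam * (B + 1)) ≤ τ := by
    refine ⟨min (κ / (2 * (B ^ 2 + 2 * B) + 1)) (τ / (2 * lam * (B + 1))), by positivity, ?_, ?_⟩
    · rw [← le_div_iff₀ (by positivity)]
      exact min_le_left _ _
    · rw [← le_div_iff₀ (by positivity)]
      exact min_le_right _ _
  obtain ⟨⟨x, t⟩, hzE, ⟨M, A⟩, hM, hθ, hmin⟩ := exists_isMin_perturbedHeight hE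
    ⟨_, hmemE x' a' hx' ha'⟩ (K := K)
    (fun z hz => (hK _ _ hz.1 hz.2).trans (by linarith [hq0 z.1])) hBE hτ'
  have hxB : ‖x‖ ≤ B := hBE _ hzE
  have hlt : ‖x - xb‖ < ρ := by
    refine lt_of_le_of_ne hzE.1 fun heq => ?_
    have h1 := hsep x _ heq hzE.2
    have h2 := hmin _ (hmemE x' a' hx' ha')
    have h3 := (abs_le.1 (abs_perturbation_le (θ := (M, A)) hxB)).1
    have h4 := (abs_le.1 (abs_perturbation_le (θ := (M, A)) (hBE _ (hmemE x' a' hx' ha')))).2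
    have h5 : ‖(M, A)‖ * (B ^ 2 + 2 * B) ≤ τ' * (B ^ 2 + 2 * B) := by gcongr
    simp only [perturbedHeight, hq] at h1 h2 h3 h4
    linarith
  obtain ⟨hMτ, hAτ⟩ : |M| ≤ τ' ∧ ‖A‖ ≤ τ' := by
    simpa [Prod.norm_def] using hθ
  rw [abs_of_nonneg hM] at hMτ
  obtain ⟨a, ha⟩ : ∃ a : ℝ, f x = a :=
    ⟨_, (EReal.coe_toReal (hzE.2.trans_lt (EReal.coe_lt_top _)).ne (hbot x)).symm⟩
  have hat : a ≤ t - q x := by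
    have := hzE.2
    simp only [ha] at this
    exact_mod_cast this
  refine ⟨x, lam⁻¹ • (v - x) - (2 * M) • x + (2 : ℝ) • A, hlt, ⟨?_, hbot x, fun ε hε => ?_⟩, ?_⟩
  · rw [ha]
    exact EReal.coe_ne_top a
  · set c := (2 * lam)⁻¹ + M with hc
    have hc0 : 0 < c := by positivity
    filter_upwards [ball_mem_nhds x (sub_pos.2 hlt), ball_mem_nhds x (div_pos hε hc0)]
      with y hy1 hy2
    rw [mem_ball, dist_eq_norm] at hy1 hy2
    by_cases htop : f y = ⊤
    · rw [htop]
      exact le_top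
    obtain ⟨b, hb⟩ : ∃ b : ℝ, f y = b := ⟨_, (EReal.coe_toReal htop (hbot y)).symm⟩
    have hyρ : ‖y - xb‖ ≤ ρ := by
      have := norm_sub_le_norm_sub_add_norm_sub y x xb
      linarith
    have h1 := hmin _ (hmemE y b hyρ hb.le)
    obtain ⟨d, rfl⟩ : ∃ d, y = x + d := ⟨y - x, by abel⟩
    rw [add_sub_cancel_left] at hy2 ⊢
    have h2 : ‖d‖ * c * ‖d‖ ≤ ε * ‖d‖ := by
      have := (lt_div_iff₀ hc0).1 hy2
      gcongr
    have h3 : ‖x + d - v‖ ^ 2 = ‖x - v‖ ^ 2 - 2 * ⟪v - x, d⟫ + ‖d‖ ^ 2 := by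
      rw [add_sub_right_comm, norm_add_sq_real, ← neg_sub v x, inner_neg_left]
      ring
    have h4 : (2 * lam)⁻¹ * (2 * ⟪v - x, d⟫) = lam⁻¹ * ⟪v - x, d⟫ := by
      field_simp
    rw [ha, hb]
    simp only [perturbedHeight, hq, h3, norm_add_sq_real x d, inner_add_right] at h1 hat
    rw [← EReal.coe_add, EReal.coe_le_coe_iff, inner_add_left, inner_sub_left, real_inner_smul_left, real_inner_smul_left,
      real_inner_smul_left]
    rw [hc] at h2
    linarith
  · have : x + lam • (lam⁻¹ • (v - x) - (2 * M) • x + (2 : ℝ) • A) - v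
        = (2 * lam) • (A - M • x) := by
      rw [smul_add, smul_sub, smul_inv_smul₀ hlam.ne']
      module
    rw [this, norm_smul, Real.norm_of_nonneg (by positivity)]
    have h1 : ‖A - M • x‖ ≤ τ' + τ' * B := by
      refine (norm_sub_le _ _).trans (add_le_add hAτ ?_)
      rw [norm_smul, Real.norm_of_nonneg hM]
      gcongr
    calc 2 * lam * ‖A - M • x‖ ≤ 2 * lam * (τ' + τ' * B) := by gcongr
      _ = τ' * (2 * lam * (B + 1)) := by ring
      _ ≤ τ := hτ'τ

lemma norm_inv_smul_sub_sub_le {lam σ ρ : ℝ} (hlam : 0 < lam) {v x xb vh : X}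
    (hv : ‖v - (lam • vh + xb)‖ ≤ σ) (hx : ‖x - xb‖ ≤ ρ) {s : X} (hs : v = x + lam • s) :
    ‖s - vh‖ ≤ (σ + ρ) / lam := by
  rw [le_div_iff₀ hlam, mul_comm, ← Real.norm_of_nonneg hlam.le, ← norm_smul]
  have : lam • (s - vh) = (v - (lam • vh + xb)) - (x - xb) := by
    rw [hs]
    module
  rw [this]
  exact (norm_sub_le _ _).trans (add_le_add hv hx)

/-- The quadratic growth near the reference point persists under small perturbations. -/
lemma quadratic_separation {lam r c σ ρ η γ a' b : ℝ} (hlam : 0 < lam) {x x' xb v vh : X}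
    (hv : ‖v - (lam • vh + xb)‖ ≤ σ) (hx : ‖x - xb‖ = ρ) (hx' : ‖x' - xb‖ ≤ η)
    (ha' : a' ≤ γ + η) (hb : γ + ⟪vh, x - xb⟫ - r / 2 * ‖x - xb‖ ^ 2 - c ≤ b) :
    a' + (2 * lam)⁻¹ * ‖x' - v‖ ^ 2 + ((2 * lam)⁻¹ * (1 - lam * r) * ρ ^ 2
      - (η + c + (2 * lam)⁻¹ * η ^ 2 + ‖vh‖ * η + lam⁻¹ * (σ * η) + lam⁻¹ * (σ * ρ)))
      ≤ b + (2 * lam)⁻¹ * ‖x - v‖ ^ 2 := by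
  obtain ⟨w, rfl⟩ : ∃ w, v = lam • vh + xb + w := ⟨v - (lam • vh + xb), by abel⟩
  obtain ⟨e, rfl⟩ : ∃ e, x = xb + e := ⟨x - xb, by abel⟩
  obtain ⟨e', rfl⟩ : ∃ e', x' = xb + e' := ⟨x' - xb, by abel⟩
  simp only [add_sub_cancel_left] at *
  have hη : 0 ≤ η := (norm_nonneg _).trans hx'
  have key : ∀ y : X, (2 * lam)⁻¹ * ‖xb + y - (lam • vh + xb + w)‖ ^ 2
      = (2 * lam)⁻¹ * ‖y‖ ^ 2 - ⟪vh, y⟫ - lam⁻¹ * ⟪w, y⟫ + (2 * lam)⁻¹ * ‖lam • vh + w‖ ^ 2 := by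
    intro y
    have h1 : xb + y - (lam • vh + xb + w) = y - (lam • vh + w) := by abel
    rw [h1, norm_sub_sq_real, real_inner_comm, inner_add_left, real_inner_smul_left]
    field_simp
    ring
  rw [key, key, hx]
  rw [hx] at hb
  have hw : ∀ y : X, ∀ R, ‖y‖ ≤ R → |⟪w, y⟫| ≤ σ * R := fun y R hy =>
    (abs_real_inner_le_norm w y).trans
      (mul_le_mul hv hy (norm_nonneg _) ((norm_nonneg _).trans hv))
  have h1 : -(‖vh‖ * η) ≤ ⟪vh, e'⟫ := by
    have h2 := (abs_le.1 (abs_real_inner_le_norm vh e')).1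
    have h3 : ‖vh‖ * ‖e'‖ ≤ ‖vh‖ * η := by gcongr
    linarith
  have h2 : lam⁻¹ * -(σ * η) ≤ lam⁻¹ * ⟪w, e'⟫ := by
    gcongr
    exact (abs_le.1 (hw e' η hx')).1
  have h3 : lam⁻¹ * ⟪w, e⟫ ≤ lam⁻¹ * (σ * ρ) := by
    gcongr
    exact (abs_le.1 (hw e ρ hx.le)).2
  have h4 : (2 * lam)⁻¹ * ‖e'‖ ^ 2 ≤ (2 * lam)⁻¹ * η ^ 2 := by gcongr
  have h5 : (2 * lam)⁻¹ * (1 - lam * r) * ρ ^ 2 = (2 * lam)⁻¹ * ρ ^ 2 - r / 2 * ρ ^ 2 := by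
    field_simp
  linarith

/-- Subgradients converging strongly along a sequence of base points are limiting subgradients
as soon as the values satisfy the prox-regularity inequality. -/
lemma mem_limSubdiff_of_tendsto {f : X → EReal} (hf : LowerSemicontinuous f)
    (hbot : ∀ x, f x ≠ ⊥) {xs ss : ℕ → X} {x s : X} {a : ℕ → ℝ} {r : ℝ}
    (hxs : Tendsto xs atTop (𝓝 x)) (hss : Tendsto ss atTop (𝓝 s))
    (hmem : ∀ k, ss k ∈ regSubdiff f (xs k)) (ha : ∀ k, f (xs k) = a k)
    (hprox : ∀ k (b : ℝ), f x ≤ b → a k + ⟪ss k, x - xs k⟫ - r / 2 * ‖x - xs k‖ ^ 2 ≤ b) :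
    s ∈ limSubdiff f x := by
  refine ⟨xs, ss, hxs, tendsto_order.2 ⟨fun y hy => hxs.eventually (hf x y hy), fun y hy => ?_⟩,
    hmem, fun z => hss.inner tendsto_const_nhds⟩
  have hc := (EReal.coe_toReal hy.ne_top (hbot x)).symm
  set c := (f x).toReal
  have hsub : Tendsto (fun k => x - xs k) atTop (𝓝 0) := by
    simpa using tendsto_const_nhds.sub hxs (a := x)
  have hlim : Tendsto (fun k => c - ⟪ss k, x - xs k⟫ + r / 2 * ‖x - xs k‖ ^ 2) atTop (𝓝 c) := by
    simpa using (tendsto_const_nhds.sub (hss.inner hsub)).add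
      ((hsub.norm.pow 2).const_mul (r / 2)) (a := c - ⟪s, (0 : X)⟫)
  have hlim' := (continuous_coe_real_ereal.tendsto c).comp hlim
  rw [hc] at hy
  filter_upwards [hlim'.eventually (gt_mem_nhds hy)] with k hk
  refine lt_of_le_of_lt ?_ hk
  rw [ha k]
  have := hprox k c hc.le
  simp only [Function.comp_apply, EReal.coe_le_coe_iff]
  linarith

/-- Local solvability of the proximal inclusion. -/
theorem exists_mem_proxMap [CompleteSpace X] {g : X → P → EReal} {xb : X} {pb : P} {vh : X}
    (hg_lsc : ∀ p, LowerSemicontinuous fun x => g x p) (hg_proper : ∀ x p, g x p ≠ ⊥)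
    (hvh : vh ∈ pSubdiff g xb pb) {lam r C δ ℓ ρ : ℝ} (hlam : 0 < lam) (hr : 0 < r)
    (hlr : lam * r < 1) (hC : 0 < C) (hδ : 0 < δ) (hℓ : 0 < ℓ)
    (h : CrossProxReg g xb pb vh r C δ)
    (hE : ∀ p, dist p pb < δ → ∃ (x' : X) (a' : ℝ), g x' p ≤ a' ∧ ‖x' - xb‖ ≤ ℓ * dist p pb ∧
      a' ≤ (g xb pb).toReal + ℓ * dist p pb)
    (hρ : 0 < ρ) (hρδ : ρ < δ) (hρlam : 3 * ρ < lam * δ) :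
    ∃ σ > 0, ∀ v p, ‖v - (lam • vh + xb)‖ ≤ σ → dist p pb ≤ σ →
      ∃ x ∈ proxMap g lam v p, ‖x - xb‖ ≤ ρ := by
  have hr' : 0 < 1 - lam * r := by linarith
  obtain ⟨γ, hγ, hγ'⟩ := h xb pb vh (by simpa) (by simpa) (by simpa) hvh
  obtain ⟨σ, hσsep, hσ, hσρ, hσℓ⟩ : ∃ σ : ℝ, (ℓ * σ + C * σ + (2 * lam)⁻¹ * (ℓ * σ) ^ 2
      + ‖vh‖ * (ℓ * σ) + lam⁻¹ * (σ * (ℓ * σ)) + lam⁻¹ * (σ * ρ)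
      < (2 * lam)⁻¹ * (1 - lam * r) * ρ ^ 2) ∧ 0 < σ ∧ σ < ρ ∧ ℓ * σ < ρ := by
    have hpos : 0 < (2 * lam)⁻¹ * (1 - lam * r) * ρ ^ 2 := by positivity
    have h1 : ∀ᶠ σ in 𝓝 (0 : ℝ), ℓ * σ + C * σ + (2 * lam)⁻¹ * (ℓ * σ) ^ 2
      + ‖vh‖ * (ℓ * σ) + lam⁻¹ * (σ * (ℓ * σ)) + lam⁻¹ * (σ * ρ)
      < (2 * lam)⁻¹ * (1 - lam * r) * ρ ^ 2 :=
      ContinuousAt.eventually_lt (by fun_prop) continuousAt_const (by simpa using hpos)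
    have h2 : ∀ᶠ σ in 𝓝 (0 : ℝ), σ < ρ := gt_mem_nhds hρ
    have h3 : ∀ᶠ σ in 𝓝 (0 : ℝ), ℓ * σ < ρ :=
      ContinuousAt.eventually_lt (by fun_prop) continuousAt_const (by simpa using hρ)
    obtain ⟨σ, ⟨a, b, c⟩, d⟩ := ((((h1.and (h2.and h3)).filter_mono nhdsWithin_le_nhds).and
      self_mem_nhdsWithin : ∀ᶠ σ in 𝓝[>] (0 : ℝ), _)).exists
    exact ⟨σ, a, d, b, c⟩
  refine ⟨σ, hσ, fun v p hv hp => ?_⟩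
  have hpδ : dist p pb < δ := by linarith
  obtain ⟨x', a', hx'a', hx', ha'⟩ := hE p hpδ
  have hd : ℓ * dist p pb ≤ ℓ * σ := by gcongr
  rw [hγ, EReal.toReal_coe] at ha'
  have hCd : C * dist pb p ≤ C * σ := by rw [dist_comm]; gcongr
  have hlow : ∀ x (b : ℝ), ‖x - xb‖ ≤ ρ → g x p ≤ b →
      γ + ⟪vh, x - xb⟫ - r / 2 * ‖x - xb‖ ^ 2 - C * σ ≤ b := fun x b hx hb => by
    have := hγ' x p b (by linarith) hpδ hb
    linarith
  have hnear : ∀ k : ℕ, ∃ x s, ‖x - xb‖ < ρ ∧ s ∈ regSubdiff (fun x => g x p) x ∧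
      ‖x + lam • s - v‖ ≤ ρ * (1 / ((k : ℝ) + 1)) := fun k =>
    exists_regSubdiff_near (hg_lsc p) (fun x => hg_proper x p) hlam (sub_pos.2 hσsep)
      (K := γ - ‖vh‖ * ρ - r / 2 * ρ ^ 2 - C * σ)
      (fun x b hx hb => by
        have h1 := hlow x b hx hb
        have h2 := (abs_le.1 (abs_real_inner_le_norm vh (x - xb))).1
        have h3 : ‖vh‖ * ‖x - xb‖ ≤ ‖vh‖ * ρ := by gcongr
        have h4 : r / 2 * ‖x - xb‖ ^ 2 ≤ r / 2 * ρ ^ 2 := by gcongr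
        linarith)
      (by linarith) hx'a'
      (fun x b hx hb => quadratic_separation hlam hv hx (hx'.trans hd) (by linarith)
        (hlow x b hx.le hb))
      (by positivity)
  choose xs ss hxs hss hvs using hnear
  have hlim1 : Tendsto (fun k : ℕ => ρ * (1 / ((k : ℝ) + 1))) atTop (𝓝 0) := by
    simpa using tendsto_one_div_add_atTop_nhds_zero_nat.const_mul ρ
  have hle1 : ∀ k : ℕ, ρ * (1 / ((k : ℝ) + 1)) ≤ ρ := fun k =>
    mul_le_of_le_one_right hρ.le (by
      rw [div_le_one (by positivity)]
      linarith [k.cast_nonneg (α := ℝ)])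
  have hss' : ∀ k, ‖ss k - vh‖ < δ := fun k => by
    have h1 : ‖xs k + lam • ss k - (lam • vh + xb)‖ ≤ ρ + σ :=
      (norm_sub_le_norm_sub_add_norm_sub _ v _).trans
        (add_le_add ((hvs k).trans (hle1 k)) hv)
    refine (norm_inv_smul_sub_sub_le hlam h1 (hxs k).le rfl).trans_lt ?_
    rw [div_lt_iff₀ hlam]
    linarith
  have hsub : ∀ k, ss k ∈ pSubdiff g (xs k) p := fun k => regSubdiff_subset_limSubdiff _ _ (hss k)
  have hmono : ∀ j k, (1 - lam * r) * ‖xs j - xs k‖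
      ≤ ‖(xs j + lam • ss j) - (xs k + lam • ss k)‖ := fun j k => by
    have h1 := h.inner_sub_ge hlam ((hxs j).trans hρδ) ((hxs k).trans hρδ) hpδ hpδ (hss' j)
      (hss' k) (hsub j) (hsub k) rfl rfl
    rw [dist_self, mul_zero, sub_zero] at h1
    have h2 := h1.trans (real_inner_le_norm _ _)
    rcases (norm_nonneg (xs j - xs k)).eq_or_lt with h0 | h0
    · rw [← h0, mul_zero]
      exact norm_nonneg _
    · rw [pow_two, ← mul_assoc] at h2
      exact le_of_mul_le_mul_right h2 h0
  have hcauchy : CauchySeq xs := by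
    refine cauchySeq_of_le_tendsto_0
      (fun k : ℕ => (1 - lam * r)⁻¹ * (2 * (ρ * (1 / ((k : ℝ) + 1))))) (fun n m N hn hm => ?_)
      (by simpa using (hlim1.const_mul 2).const_mul (1 - lam * r)⁻¹)
    have hanti : ∀ n, N ≤ n → ‖xs n + lam • ss n - v‖ ≤ ρ * (1 / ((N : ℝ) + 1)) := fun n hn =>
      (hvs n).trans (by gcongr)
    rw [dist_eq_norm, le_inv_mul_iff₀ hr']
    refine (hmono n m).trans ?_
    rw [← sub_sub_sub_cancel_right _ _ v]
    refine (norm_sub_le _ _).trans ?_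
    linarith [hanti n hn, hanti m hm]
  obtain ⟨x, hx⟩ := cauchySeq_tendsto_of_complete hcauchy
  have hxρ : ‖x - xb‖ ≤ ρ :=
    le_of_tendsto (hx.sub_const xb).norm (Eventually.of_forall fun k => (hxs k).le)
  have hvlim : Tendsto (fun k => xs k + lam • ss k) atTop (𝓝 v) :=
    tendsto_iff_norm_sub_tendsto_zero.2
      (squeeze_zero (fun _ => norm_nonneg _) hvs hlim1)
  have hslim : Tendsto ss atTop (𝓝 (lam⁻¹ • (v - x))) := by
    refine ((hvlim.sub hx).const_smul lam⁻¹).congr fun k => ?_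
    rw [add_sub_cancel_left, inv_smul_smul₀ hlam.ne']
  choose a ha hprox using fun k =>
    h (xs k) p (ss k) ((hxs k).trans hρδ) hpδ (hss' k) (hsub k)
  refine ⟨x, ⟨_, mem_limSubdiff_of_tendsto (hg_lsc p) (fun x => hg_proper x p) hx hslim hss ha
    (r := r) fun k b hb => ?_, ?_⟩, hxρ⟩
  · simpa using hprox k x p b (by linarith) hpδ hb
  · rw [smul_inv_smul₀ hlam.ne']
    abel

/-- Hölderian single-valued localization of the proximal mapping
(Lemma 6.2). -/
theorem statement7
    {X : Type*} [NormedAddCommGroup X] [InnerProductSpace ℝ X] [CompleteSpace X]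
    {P : Type*} [MetricSpace P]
    (g : X → P → EReal) (xb vh : X) (pb : P)
    (hg_lsc : LowerSemicontinuous fun t : X × P => g t.1 t.2)
    (hg_proper : ∀ x p, g x p ≠ ⊥)
    (hvh : vh ∈ pSubdiff g xb pb)
    (hA2 : A2 g xb pb vh) (hA3 : A3 g xb pb)
    (lam r : ℝ) (hlam : 0 < lam)
    (hr : proxThreshold g xb pb vh < r) (hlr : lam * r < 1) :
    ∃ Wn ∈ 𝓝 (lam • vh + xb), ∃ Pn ∈ 𝓝 pb, ∃ U ∈ 𝓝 xb, ∃ π : X → P → X,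
      Localizes2 (proxMap g lam) Wn Pn U π ∧
      ∃ ℓ₀ > (0:ℝ), ∀ v₁ ∈ Wn, ∀ p₁ ∈ Pn, ∀ v₂ ∈ Wn, ∀ p₂ ∈ Pn,
        ‖(v₁ - v₂) - (2 * (1 - lam * r)) • (π v₁ p₁ - π v₂ p₂)‖
          ≤ ‖v₁ - v₂‖ + ℓ₀ * Real.sqrt (dist p₁ p₂) := by
  obtain ⟨r₀, ⟨hr₀, hprox⟩, hr₀r⟩ := exists_lt_of_csInf_lt hA2.1 hr
  have hr0 : 0 < r := hr₀.trans hr₀r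
  obtain ⟨C, hC, δ, hδ, ℓ, hℓ, h, hE⟩ := exists_crossProxReg hg_lsc hg_proper hvh hr0
    (hprox.mono hr₀r.le) hA2.2 hA3
  obtain ⟨ρ, hρ, hρδ, hρlam⟩ : ∃ ρ > 0, ρ < δ ∧ 3 * ρ < lam * δ := by
    obtain ⟨ρ, hρ, hρ'⟩ := exists_between (show 0 < min δ (lam * δ / 3) by positivity)
    refine ⟨ρ, hρ, hρ'.trans_le (min_le_left _ _), ?_⟩
    linarith [hρ'.trans_le (min_le_right _ _)]
  obtain ⟨σ, hσ, hex⟩ := exists_mem_proxMap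
    (fun p => hg_lsc.comp (Continuous.prodMk_left p)) hg_proper hvh hlam
    hr0 hlr hC hδ hℓ h hE hρ hρδ hρlam
  have hκ : 0 < 1 - lam * r := by linarith
  have hmin : 0 < min σ ρ := lt_min hσ hρ
  choose! π hπmem hπρ using hex
  have hmono : ∀ v₁ p₁ x₁ v₂ p₂ x₂, v₁ ∈ closedBall (lam • vh + xb) (min σ ρ) →
      p₁ ∈ closedBall pb (min σ ρ) → x₁ ∈ closedBall xb ρ → x₁ ∈ proxMap g lam v₁ p₁ →
      v₂ ∈ closedBall (lam • vh + xb) (min σ ρ) → p₂ ∈ closedBall pb (min σ ρ) →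
      x₂ ∈ closedBall xb ρ → x₂ ∈ proxMap g lam v₂ p₂ →
      (1 - lam * r) * ‖x₁ - x₂‖ ^ 2 - 2 * lam * C * dist p₁ p₂ ≤ ⟪v₁ - v₂, x₁ - x₂⟫ := by
    rintro v₁ p₁ x₁ v₂ p₂ x₂ hv₁ hp₁ hx₁ ⟨s₁, hs₁, e₁⟩ hv₂ hp₂ hx₂ ⟨s₂, hs₂, e₂⟩
    rw [mem_closedBall] at hp₁ hp₂
    rw [mem_closedBall, dist_eq_norm] at hv₁ hx₁ hv₂ hx₂
    have hbd : (min σ ρ + ρ) / lam < δ := by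
      rw [div_lt_iff₀ hlam]
      linarith [min_le_right σ ρ]
    exact h.inner_sub_ge hlam (hx₁.trans_lt hρδ) (hx₂.trans_lt hρδ)
      ((hp₁.trans (min_le_right _ _)).trans_lt hρδ) ((hp₂.trans (min_le_right _ _)).trans_lt hρδ)
      ((norm_inv_smul_sub_sub_le hlam hv₁ hx₁ e₁).trans_lt hbd)
      ((norm_inv_smul_sub_sub_le hlam hv₂ hx₂ e₂).trans_lt hbd) hs₁ hs₂ e₁ e₂
  have hπ : ∀ v ∈ closedBall (lam • vh + xb) (min σ ρ), ∀ p ∈ closedBall pb (min σ ρ),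
      π v p ∈ closedBall xb ρ ∧ π v p ∈ proxMap g lam v p := by
    intro v hv p hp
    rw [mem_closedBall, dist_eq_norm] at hv
    have hv' := hv.trans (min_le_left _ _)
    have hp' := (mem_closedBall.1 hp).trans (min_le_left _ _)
    exact ⟨by rw [mem_closedBall, dist_eq_norm]; exact hπρ v p hv' hp', hπmem v p hv' hp'⟩
  refine ⟨_, closedBall_mem_nhds _ hmin, _, closedBall_mem_nhds _ hmin, _,
    closedBall_mem_nhds _ hρ, π, fun v hv p hp => ⟨(hπ v hv p hp).1, (hπ v hv p hp).2,
    fun x hx hxmem => ?_⟩, Real.sqrt (4 * (1 - lam * r) * (2 * lam * C)), by positivity,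
    fun v₁ hv₁ p₁ hp₁ v₂ hv₂ p₂ hp₂ => ?_⟩
  · have h1 := hmono v p x v p (π v p) hv hp hx hxmem hv hp (hπ v hv p hp).1 (hπ v hv p hp).2
    rw [dist_self, sub_self, inner_zero_left, mul_zero, sub_zero] at h1
    have h2 : ‖x - π v p‖ ^ 2 ≤ 0 := nonpos_of_mul_nonpos_right h1 hκ
    rw [← sub_eq_zero, ← norm_eq_zero]
    exact pow_eq_zero_iff two_ne_zero |>.1 (le_antisymm h2 (sq_nonneg _))
  · obtain ⟨hx₁, hm₁⟩ := hπ v₁ hv₁ p₁ hp₁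
    obtain ⟨hx₂, hm₂⟩ := hπ v₂ hv₂ p₂ hp₂
    have h1 := hmono v₁ p₁ _ v₂ p₂ _ hv₁ hp₁ hx₁ hm₁ hv₂ hp₂ hx₂ hm₂
    rw [← Real.sqrt_mul (by positivity)]
    set D := 4 * (1 - lam * r) * (2 * lam * C) * dist p₁ p₂ with hD
    have hD0 : 0 ≤ D := by positivity
    refine le_of_sq_le_sq ?_ (by positivity)
    rw [norm_sub_sq_real, real_inner_smul_right, norm_smul, Real.norm_of_nonneg (by positivity),
      add_sq, Real.sq_sqrt hD0]
    have h2 : 0 ≤ 2 * ‖v₁ - v₂‖ * Real.sqrt D := by positivity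
    have h3 := mul_le_mul_of_nonneg_left h1 (show 0 ≤ 4 * (1 - lam * r) by positivity)
    linarith

end PVS
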